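/- Let P be a type of proposals with functions round : P → ℕ and decision : P → Bool, and let Pre, Com : P → Prop be predicates. Assume: (i) for all p, q, if Pre p, Pre q and round p = round q then p = q; (ii) for all p, q, if Com p, Pre q and round q > round p, then there exists r with Pre r, round p ≤ round r < round q, and decision r = decision q; and (iii) for all p, Com p implies Pre p. Then for all p, q, if Com p and Com q then decision p = decision q. -/

import Mathlib

/-- A pre-committed proposal whose round is at least that of a committed proposal carries
the same decision value. -/
theorem decision_eq_of_committed_of_round_le {P : Type*}
    {round : P → ℕ} {decision : P → Bool} {Pre Com : P → Prop}
    (unique : ∀ p q : P, Pre p → Pre q → round p = round q → p = q)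
    (locking : ∀ p q : P, Com p → Pre q → round p < round q →
      ∃ r : P, Pre r ∧ round p ≤ round r ∧ round r < round q ∧
        decision r = decision q)
    (pre_of_com : ∀ p : P, Com p → Pre p) {p : P} (hp : Com p) (q : P)
    (hq : Pre q) (hpq : round p ≤ round q) : decision p = decision q := by
  induction q using (measure round).wf.induction with
  | h q ih =>
    rcases hpq.eq_or_lt with heq | hlt
    · rw [unique p q (pre_of_com p hp) hq heq]
    · obtain ⟨r, hr, hpr, hrq, hdec⟩ := locking p q hp hq hlt
      exact (ih r hrq hr hpr).trans hdec

/-- Agreement: given (i) uniqueness of pre-committed proposals per round,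
(ii) the locking property, and (iii) that any committed proposal is also
pre-committed, any two commit certificates carry the same decision value. -/
theorem commit_agreement {P : Type*}
    (round : P → ℕ) (decision : P → Bool) (Pre Com : P → Prop)
    (h₁ : ∀ p q : P, Pre p → Pre q → round p = round q → p = q)
    (h₂ : ∀ p q : P, Com p → Pre q → round p < round q →
      ∃ r : P, Pre r ∧ round p ≤ round r ∧ round r < round q ∧
        decision r = decision q)
    (h₃ : ∀ p : P, Com p → Pre p) :
    ∀ p q : P, Com p → Com q → decision p = decision q := by
  intro p q hp hq
  rcases le_total (round p) (round q) with h | h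
  · exact decision_eq_of_committed_of_round_le h₁ h₂ h₃ hp q (h₃ q hq) h
  · exact (decision_eq_of_committed_of_round_le h₁ h₂ h₃ hq p (h₃ p hp) h).symm
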